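/- There exist no real number k ≠ 0, nonnegative integer m, and integer p with p² + p − 2 ≠ 0 such that simultaneously k = 1/(m+2)² − 1 and k = −p(p+1)/(p² + p − 2). -/

import Mathlib

/-- There exist no real number `k ≠ 0`, nonnegative integer `m`, and integer `p`
with `p² + p − 2 ≠ 0` such that simultaneously `k = 1/(m+2)² − 1` and
`k = −p(p+1)/(p² + p − 2)`. -/
theorem spring_pendulum_incompatible_families :
    ¬ ∃ (k : ℝ) (m : ℕ) (p : ℤ), k ≠ 0 ∧ (p ^ 2 + p - 2 : ℤ) ≠ 0 ∧
      k = 1 / ((m : ℝ) + 2) ^ 2 - 1 ∧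
      k = -((p : ℝ) * ((p : ℝ) + 1)) / ((p : ℝ) ^ 2 + (p : ℝ) - 2) := by
  rintro ⟨k, m, p, -, hp, hm, hk⟩
  have hd : (p : ℝ) ^ 2 + (p : ℝ) - 2 ≠ 0 := by exact_mod_cast hp
  have hn : (m : ℝ) + 2 ≠ 0 := by positivity
  have key : (p : ℝ) ^ 2 + (p : ℝ) - 2 = -2 * ((m : ℝ) + 2) ^ 2 := by
    rw [hm, eq_div_iff hd] at hk
    field_simp at hk
    linear_combination hk
  have hm0 : (0 : ℝ) ≤ m := m.cast_nonneg
  nlinarith [sq_nonneg ((p : ℝ) + 1 / 2)]
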